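/- arXiv:0901.0298 — 11 statements merged into one kernel-verified Lean document; each statement's English description precedes it below -/
import Mathlib

section
/- Let f : ℝ → ℝ be differentiable, let u₁, u₂ be real numbers with f'(u₁) ≠ f'(u₂), let ξ₁, ξ₂ ∈ ℝ, and define the particle trajectories x₁(t) = ξ₁ + f'(u₁)·t and x₂(t) = ξ₂ + f'(u₂)·t. Define X(u,t) = x₁(t) + ((f'(u) − f'(u₁)) / (f'(u₂) − f'(u₁)))·(x₂(t) − x₁(t)). Then for every u ∈ ℝ and every t ∈ ℝ, the partial derivative of X with respect to t satisfies ∂X/∂t (u,t) = f'(u); that is, every level set of the interpolant moves with the characteristic speed of the conservation law u_t + f(u)_x = 0. -/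
/-- Every level set of the similarity interpolant
`X(u,t) = x₁(t) + ((f'(u) − f'(u₁))/(f'(u₂) − f'(u₁)))·(x₂(t) − x₁(t))`,
where `xᵢ(t) = ξᵢ + f'(uᵢ)·t`, moves with characteristic speed: `∂X/∂t (u,t) = f'(u)`. -/
theorem similarity_interpolant_moves_with_characteristic_speed
    (f : ℝ → ℝ) (hf : Differentiable ℝ f) (u₁ u₂ : ℝ)
    (hne : deriv f u₁ ≠ deriv f u₂) (ξ₁ ξ₂ : ℝ)
    (x₁ x₂ : ℝ → ℝ)
    (hx₁ : x₁ = fun t => ξ₁ + deriv f u₁ * t)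
    (hx₂ : x₂ = fun t => ξ₂ + deriv f u₂ * t)
    (X : ℝ → ℝ → ℝ)
    (hX : X = fun u t => x₁ t +
      ((deriv f u - deriv f u₁) / (deriv f u₂ - deriv f u₁)) * (x₂ t - x₁ t)) :
    ∀ u t : ℝ, HasDerivAt (fun s => X u s) (deriv f u) t := by
  intro u t
  subst hX hx₁ hx₂
  have hd : deriv f u₂ - deriv f u₁ ≠ 0 := sub_ne_zero.mpr hne.symm
  have affine (ξ c : ℝ) : HasDerivAt (fun s => ξ + c * s) c t := by
    simpa using ((hasDerivAt_id t).const_mul c).const_add ξ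
  have h := (affine ξ₁ (deriv f u₁)).add
    (((affine ξ₂ (deriv f u₂)).sub (affine ξ₁ (deriv f u₁))).const_mul
      ((deriv f u - deriv f u₁) / (deriv f u₂ - deriv f u₁)))
  rw [div_mul_cancel₀ _ hd, add_sub_cancel] at h
  exact h
end

section
/- Let f : ℝ → ℝ be twice continuously differentiable, let u₁ < u₂ with f''(v) > 0 for all v ∈ [u₁,u₂], let ξ₁, ξ₂ ∈ ℝ, and set x₁(t) = ξ₁ + f'(u₁)·t, x₂(t) = ξ₂ + f'(u₂)·t and X(u,t) = x₁(t) + ((f'(u) − f'(u₁)) / (f'(u₂) − f'(u₁)))·(x₂(t) − x₁(t)). Let I ⊆ ℝ be an open interval of times on which x₁(t) < x₂(t). Then on the open set Ω = {(x,t) : t ∈ I, x strictly between x₁(t) and x₂(t)} there is a continuously differentiable function u(x,t) uniquely determined by X(u(x,t), t) = x together with u(x,t) ∈ (u₁,u₂), and this function is a classical solution of the conservation law: ∂u/∂t + f'(u)·∂u/∂x = 0 on Ω. -/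
open Set Filter Topology in
/-- The inverse of a strictly increasing function on an interval, restricted to the open image
interval, is `C¹` as soon as the function is `C¹` with positive derivative. -/
theorem exists_contDiffAt_inverse_Ioo {g : ℝ → ℝ} (hg : ContDiff ℝ 1 g) {a b : ℝ} (hab : a < b)
    (hpos : ∀ v ∈ Icc a b, 0 < deriv g v) :
    ∃ h : ℝ → ℝ, ∀ w ∈ Ioo (g a) (g b),
      h w ∈ Ioo a b ∧ g (h w) = w ∧ ContDiffAt ℝ 1 h w := by
  have hmono : StrictMonoOn g (Icc a b) :=
    strictMonoOn_of_deriv_pos (convex_Icc a b) hg.continuous.continuousOn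
      fun v hv => hpos v (interior_subset hv)
  have hsurj : ∀ w : ℝ, ∃ v, w ∈ Ioo (g a) (g b) → v ∈ Ioo a b ∧ g v = w := by
    intro w
    by_cases hw : w ∈ Ioo (g a) (g b)
    · obtain ⟨v, hv, hvw⟩ := intermediate_value_Ioo hab.le hg.continuous.continuousOn hw
      exact ⟨v, fun _ => ⟨hv, hvw⟩⟩
    · exact ⟨0, fun hw' => absurd hw' hw⟩
  choose h hh using hsurj
  refine ⟨h, fun w hw => ⟨(hh w hw).1, (hh w hw).2, ?_⟩⟩
  obtain ⟨hmem, hval⟩ := hh w hw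
  have hne : deriv g (h w) ≠ 0 := (hpos _ (Ioo_subset_Icc_self hmem)).ne'
  have hgd : HasFDerivAt g
      ((ContinuousLinearEquiv.unitsEquivAut ℝ (Units.mk0 _ hne) : ℝ ≃L[ℝ] ℝ) : ℝ →L[ℝ] ℝ)
      (h w) :=
    (hg.differentiable one_ne_zero (h w)).hasDerivAt.hasFDerivAt_equiv hne
  have hgc : ContDiffAt ℝ 1 g (h w) := hg.contDiffAt
  have hs := hgc.hasStrictFDerivAt' hgd one_ne_zero
  have hk := hgc.to_localInverse hgd one_ne_zero
  have hkw : hgc.localInverse hgd one_ne_zero w = h w := by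
    have := hgc.localInverse_apply_image hgd one_ne_zero
    rwa [hval] at this
  have hright : ∀ᶠ y in 𝓝 w, g (hgc.localInverse hgd one_ne_zero y) = y := by
    have := hs.eventually_right_inverse
    rwa [hval] at this
  rw [hval] at hk
  refine hk.congr_of_eventuallyEq ?_
  have hkmem : ∀ᶠ y in 𝓝 w, hgc.localInverse hgd one_ne_zero y ∈ Ioo a b :=
    hk.continuousAt.eventually (isOpen_Ioo.mem_nhds (hkw.symm ▸ hmem))
  filter_upwards [hright, hkmem, isOpen_Ioo.mem_nhds hw] with y hy hym hyw
  exact hmono.injOn (Ioo_subset_Icc_self (hh y hyw).1) (Ioo_subset_Icc_self hym)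
    ((hh y hyw).2.trans hy.symm)


/-- Between two characteristic particles, the similarity interpolant defines
a C¹ function `u(x,t)` (uniquely determined by `X(u(x,t),t) = x` and `u(x,t) ∈ (u₁,u₂)`)
that is a classical solution of the conservation law `u_t + f'(u)·u_x = 0` on the open
region between the particle trajectories. -/
theorem interpolant_is_classical_solution
    (f : ℝ → ℝ) (hf : ContDiff ℝ 2 f) (u₁ u₂ : ℝ) (h12 : u₁ < u₂)
    (hconv : ∀ v ∈ Set.Icc u₁ u₂, 0 < deriv (deriv f) v)
    (ξ₁ ξ₂ : ℝ)
    (x₁ x₂ : ℝ → ℝ)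
    (hx₁ : x₁ = fun t => ξ₁ + deriv f u₁ * t)
    (hx₂ : x₂ = fun t => ξ₂ + deriv f u₂ * t)
    (X : ℝ → ℝ → ℝ)
    (hX : X = fun u t => x₁ t +
      ((deriv f u - deriv f u₁) / (deriv f u₂ - deriv f u₁)) * (x₂ t - x₁ t))
    (I : Set ℝ) (hIopen : IsOpen I) (hIconn : I.OrdConnected)
    (horder : ∀ t ∈ I, x₁ t < x₂ t) :
    ∃ u : ℝ → ℝ → ℝ,
      ContDiffOn ℝ 1 (fun p : ℝ × ℝ => u p.1 p.2)
        {p : ℝ × ℝ | p.2 ∈ I ∧ p.1 ∈ Set.Ioo (x₁ p.2) (x₂ p.2)} ∧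
      ∀ t ∈ I, ∀ x ∈ Set.Ioo (x₁ t) (x₂ t),
        u x t ∈ Set.Ioo u₁ u₂ ∧
        X (u x t) t = x ∧
        (∀ v ∈ Set.Ioo u₁ u₂, X v t = x → v = u x t) ∧
        ∃ ut ux : ℝ,
          HasDerivAt (fun s => u x s) ut t ∧
          HasDerivAt (fun y => u y t) ux x ∧
          ut + deriv f (u x t) * ux = 0 := by
  have hg : ContDiff ℝ 1 (deriv f) := by
    have : ContDiff ℝ (1 + 1) f := by simpa [one_add_one_eq_two] using hf
    exact (contDiff_succ_iff_deriv.1 this).2.2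
  have hmono : StrictMonoOn (deriv f) (Set.Icc u₁ u₂) :=
    strictMonoOn_of_deriv_pos (convex_Icc u₁ u₂) hg.continuous.continuousOn
      fun v hv => hconv v (interior_subset hv)
  have hG : 0 < deriv f u₂ - deriv f u₁ :=
    sub_pos.2 (hmono (Set.left_mem_Icc.2 h12.le) (Set.right_mem_Icc.2 h12.le) h12)
  obtain ⟨h, hh⟩ := exists_contDiffAt_inverse_Ioo hg h12 hconv
  generalize deriv f = g at *
  set S : ℝ → ℝ → ℝ := fun x t => g u₁ + (x - x₁ t) / (x₂ t - x₁ t) * (g u₂ - g u₁) with hS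
  have hSmem : ∀ t ∈ I, ∀ x ∈ Set.Ioo (x₁ t) (x₂ t), S x t ∈ Set.Ioo (g u₁) (g u₂) := by
    intro t ht x hx
    have hD : 0 < x₂ t - x₁ t := sub_pos.2 (horder t ht)
    have h0 : 0 < (x - x₁ t) / (x₂ t - x₁ t) := div_pos (sub_pos.2 hx.1) hD
    have h1 : (x - x₁ t) / (x₂ t - x₁ t) < 1 := (div_lt_one hD).2 (by linarith [hx.2])
    constructor <;> simp only [hS] <;> nlinarith
  refine ⟨fun x t => h (S x t), ?_, ?_⟩
  · rintro ⟨x, t⟩ ⟨ht, hx⟩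
    have hD : x₂ t - x₁ t ≠ 0 := (sub_pos.2 (horder t ht)).ne'
    have hSc : ContDiffAt ℝ 1 (fun p : ℝ × ℝ => S p.1 p.2) (x, t) := by
      subst hx₁ hx₂
      refine contDiffAt_const.add (ContDiffAt.mul (ContDiffAt.div ?_ ?_ hD) contDiffAt_const)
      all_goals fun_prop
    exact (ContDiffAt.comp (x, t) (hh _ (hSmem t ht x hx)).2.2 hSc).contDiffWithinAt
  · intro t ht x hx
    obtain ⟨hmem, hval, hcd⟩ := hh _ (hSmem t ht x hx)
    have hD : x₂ t - x₁ t ≠ 0 := (sub_pos.2 (horder t ht)).ne'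
    have hd := (hcd.differentiableAt one_ne_zero).hasDerivAt
    refine ⟨hmem, ?_, ?_, ?_⟩
    · simp only [hX, hval]
      simp only [hS]
      field_simp
      ring
    · intro v hv hXv
      refine hmono.injOn (Set.Ioo_subset_Icc_self hv) (Set.Ioo_subset_Icc_self hmem) ?_
      rw [hval, ← hXv]
      simp only [hX, hS]
      field_simp
      ring
    · have h1 : HasDerivAt x₁ (g u₁) t := by
        rw [hx₁]; simpa using ((hasDerivAt_id t).const_mul (g u₁)).const_add ξ₁
      have h2 : HasDerivAt x₂ (g u₂) t := by
        rw [hx₂]; simpa using ((hasDerivAt_id t).const_mul (g u₂)).const_add ξ₂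
      have hSt := (((h1.const_sub x).div (h2.sub h1) hD).mul_const (g u₂ - g u₁)).const_add (g u₁)
      have hSx := ((((hasDerivAt_id x).sub_const (x₁ t)).div_const
        (x₂ t - x₁ t)).mul_const (g u₂ - g u₁)).const_add (g u₁)
      refine ⟨_, _, HasDerivAt.comp t hd hSt, HasDerivAt.comp x hd hSx, ?_⟩
      rw [hval]
      simp only [hS, Pi.sub_apply]
      field_simp
      ring
end

section
/- Let f : ℝ → ℝ be twice continuously differentiable, let u₀ : ℝ → ℝ be continuously differentiable, and let T > 0. For t ∈ [0,T) define Φ_t : ℝ → ℝ by Φ_t(x₀) = x₀ + f'(u₀(x₀))·t, and assume that for every t ∈ [0,T) the map Φ_t is a bijection of ℝ whose derivative x₀ ↦ 1 + t·(f'∘u₀)'(x₀) is everywhere strictly positive. Then the function u(x,t) := u₀(Φ_t⁻¹(x)) is continuously differentiable on ℝ × (0,T), satisfies u(x,0) = u₀(x), is constant along each characteristic (u(Φ_t(x₀), t) = u₀(x₀) for all x₀ and t), and is a classical solution of the conservation law: ∂u/∂t + f'(u)·∂u/∂x = 0 on ℝ × (0,T). -/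
open Filter Topology

/-- If `(y, s) ↦ y + c y * s` has nonzero `y`-derivative at `(y₀, t)`, then any fibrewise inverse
`g` of this family, defined for times near `t`, is `C¹` near `(y₀ + c y₀ * t, t)`. -/
lemma contDiffAt_characteristic_inverse {c : ℝ → ℝ} (hc : ContDiff ℝ 1 c) {g : ℝ × ℝ → ℝ}
    {y₀ t : ℝ} (hg : ∀ᶠ s in 𝓝 t, ∀ y, g (y + c y * s, s) = y)
    (hne : 1 + t * deriv c y₀ ≠ 0) :
    ContDiffAt ℝ 1 g (y₀ + c y₀ * t, t) := by
  set F : ℝ × ℝ → ℝ × ℝ := fun p => (p.1 + c p.1 * p.2, p.2)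
  have hFc : ContDiffAt ℝ 1 F (y₀, t) := by
    have : ContDiff ℝ 1 F := by fun_prop
    exact this.contDiffAt
  set a := 1 + t * deriv c y₀ with ha
  let fst := ContinuousLinearMap.fst ℝ ℝ ℝ
  let snd := ContinuousLinearMap.snd ℝ ℝ ℝ
  let L : (ℝ × ℝ) ≃L[ℝ] (ℝ × ℝ) := ContinuousLinearEquiv.equivOfInverse
    ((a • fst + c y₀ • snd).prod snd) ((a⁻¹ • (fst - c y₀ • snd)).prod snd)
    (fun p => by ext <;> simp [fst, snd, hne])
    (fun p => by ext <;> simp [fst, snd, hne])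
  have hFd : HasFDerivAt F (L : (ℝ × ℝ) →L[ℝ] (ℝ × ℝ)) (y₀, t) := by
    have hcd : HasDerivAt c (deriv c y₀) (y₀, t).1 :=
      (hc.differentiable one_ne_zero y₀).hasDerivAt
    have h1 : HasFDerivAt (fun p : ℝ × ℝ => p.1) fst (y₀, t) := hasFDerivAt_fst
    have h2 : HasFDerivAt (fun p : ℝ × ℝ => p.2) snd (y₀, t) := hasFDerivAt_snd
    have h := (h1.add ((hcd.comp_hasFDerivAt (y₀, t) h1).mul h2)).prodMk h2
    refine h.congr_fderiv ?_
    ext <;> simp [L, fst, snd, ha]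
  have hFs := hFc.hasStrictFDerivAt' hFd one_ne_zero
  have hinv := hFs.eventually_right_inverse
  have hloc := hFc.to_localInverse hFd one_ne_zero
  refine hloc.fst.congr_of_eventuallyEq ?_
  have hg' : ∀ᶠ p : ℝ × ℝ in 𝓝 (F (y₀, t)), ∀ y, g (y + c y * p.2, p.2) = y :=
    (continuous_snd.tendsto (F (y₀, t))).eventually hg
  filter_upwards [hinv, hg'] with p hp hgp
  obtain ⟨y, s⟩ := p
  set q := hFs.localInverse F L (y₀, t) (y, s)
  obtain ⟨h1, h2⟩ : q.1 + c q.1 * q.2 = y ∧ q.2 = s := Prod.ext_iff.mp hp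
  have h := hgp q.1
  rw [← h2, h1, h2] at h
  exact h

/-- As long as the characteristic map `Φ_t(x₀) = x₀ + f'(u₀(x₀))·t` remains a
bijection of `ℝ` with everywhere positive derivative `1 + t·(f'∘u₀)'(x₀)`, the function
`u(x,t) = u₀(Φ_t⁻¹(x))` is C¹, attains the initial data at `t = 0`, is constant along
characteristics, and is a classical solution of `u_t + f'(u)·u_x = 0` on `ℝ × (0,T)`. -/
theorem method_of_characteristics_solution
    (f : ℝ → ℝ) (hf : ContDiff ℝ 2 f)
    (u₀ : ℝ → ℝ) (hu₀ : ContDiff ℝ 1 u₀)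
    (T : ℝ) (hT : 0 < T)
    (Φ : ℝ → ℝ → ℝ)
    (hΦ : Φ = fun t x₀ => x₀ + deriv f (u₀ x₀) * t)
    (hbij : ∀ t ∈ Set.Ico 0 T, Function.Bijective (Φ t))
    (hpos : ∀ t ∈ Set.Ico 0 T, ∀ x₀ : ℝ,
      HasDerivAt (Φ t) (1 + t * deriv (fun y => deriv f (u₀ y)) x₀) x₀ ∧
      0 < 1 + t * deriv (fun y => deriv f (u₀ y)) x₀)
    (u : ℝ → ℝ → ℝ)
    (hu : u = fun x t => u₀ (Function.invFun (Φ t) x)) :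
    ContDiffOn ℝ 1 (fun p : ℝ × ℝ => u p.1 p.2) (Set.univ ×ˢ Set.Ioo 0 T) ∧
    (∀ x : ℝ, u x 0 = u₀ x) ∧
    (∀ x₀ : ℝ, ∀ t ∈ Set.Ico 0 T, u (Φ t x₀) t = u₀ x₀) ∧
    (∀ x : ℝ, ∀ t ∈ Set.Ioo 0 T,
      ∃ ut ux : ℝ,
        HasDerivAt (fun s => u x s) ut t ∧
        HasDerivAt (fun y => u y t) ux x ∧
        ut + deriv f (u x t) * ux = 0) := by
  set c : ℝ → ℝ := fun y => deriv f (u₀ y)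
  have hc : ContDiff ℝ 1 c :=
    (hf.deriv' (n := 1)).comp hu₀
  have hchar : ∀ x₀ : ℝ, ∀ t ∈ Set.Ico 0 T, u (Φ t x₀) t = u₀ x₀ := fun x₀ t ht => by
    simp only [hu, Function.leftInverse_invFun (hbij t ht).1 x₀]
  have hC1 : ∀ x₀ : ℝ, ∀ t ∈ Set.Ioo 0 T,
      ContDiffAt ℝ 1 (fun p : ℝ × ℝ => u p.1 p.2) (Φ t x₀, t) := fun x₀ t ht => by
    have hg : ∀ᶠ s in 𝓝 t, ∀ y,
        (fun p : ℝ × ℝ => Function.invFun (Φ p.2) p.1) (y + c y * s, s) = y := by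
      filter_upwards [isOpen_Ioo.mem_nhds ht] with s hs y
      have := Function.leftInverse_invFun (hbij s (Set.Ioo_subset_Ico_self hs)).1 y
      simpa only [hΦ] using this
    have h := contDiffAt_characteristic_inverse
      (g := fun p => Function.invFun (Φ p.2) p.1) hc hg
      (hpos t (Set.Ioo_subset_Ico_self ht) x₀).2.ne'
    simp only [hu]
    rw [show Φ t x₀ = x₀ + c x₀ * t by rw [hΦ]]
    exact hu₀.contDiffAt.comp _ h
  refine ⟨?_, fun x => ?_, hchar, fun x t ht => ?_⟩
  · rintro ⟨x, t⟩ ⟨-, ht⟩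
    obtain ⟨x₀, rfl⟩ := (hbij t (Set.Ioo_subset_Ico_self ht)).2 x
    exact (hC1 x₀ t ht).contDiffWithinAt
  · simpa [hΦ] using hchar x 0 ⟨le_rfl, hT⟩
  · obtain ⟨x₀, rfl⟩ := (hbij t (Set.Ioo_subset_Ico_self ht)).2 x
    have hU := ((hC1 x₀ t ht).differentiableAt one_ne_zero).hasFDerivAt
    set L := fderiv ℝ (fun p : ℝ × ℝ => u p.1 p.2) (Φ t x₀, t)
    have hcurve : HasDerivAt (fun s => (Φ s x₀, s)) (c x₀, (1 : ℝ)) t := by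
      refine HasDerivAt.prodMk ?_ (hasDerivAt_id t)
      simpa [hΦ] using ((hasDerivAt_id t).const_mul (c x₀)).const_add x₀
    have hconst : HasDerivAt (fun s => u (Φ s x₀) s) 0 t := by
      refine (hasDerivAt_const t (u₀ x₀)).congr_of_eventuallyEq ?_
      filter_upwards [isOpen_Ioo.mem_nhds ht] with s hs
      exact hchar x₀ s (Set.Ioo_subset_Ico_self hs)
    have hL : L (c x₀, 1) = 0 :=
      (HasFDerivAt.comp_hasDerivAt_of_eq t hU hcurve rfl).unique hconst
    refine ⟨L (0, 1), L (1, 0), ?_, ?_, ?_⟩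
    · exact HasFDerivAt.comp_hasDerivAt t hU
        ((hasDerivAt_const t (Φ t x₀)).prodMk (hasDerivAt_id t))
    · exact HasFDerivAt.comp_hasDerivAt (Φ t x₀) hU
        ((hasDerivAt_id (Φ t x₀)).prodMk (hasDerivAt_const (Φ t x₀) t))
    · rw [hchar x₀ t (Set.Ioo_subset_Ico_self ht), ← smul_eq_mul, ← map_smul, ← map_add]
      simpa [c] using hL
end

section
/- Let f : ℝ → ℝ be twice continuously differentiable, let u₁ < u₂ with f''(v) > 0 for all v ∈ [u₁,u₂], and let x₁ < x₂. Let X(u) = x₁ + ((f'(u) − f'(u₁)) / (f'(u₂) − f'(u₁)))·(x₂ − x₁), which maps [u₁,u₂] strictly monotonically onto [x₁,x₂], and let w : [x₁,x₂] → [u₁,u₂] be its inverse. Then ∫_{x₁}^{x₂} w(x) dx = (x₂ − x₁) · a(u₁,u₂), where a(u₁,u₂) = ((f'(u₂)·u₂ − f(u₂)) − (f'(u₁)·u₁ − f(u₁))) / (f'(u₂) − f'(u₁)) is the nonlinear average. -/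
/-- The area under the inverse `w` of the similarity interpolant
`X(u) = x₁ + ((f'(u) − f'(u₁))/(f'(u₂) − f'(u₁)))·(x₂ − x₁)` on `[x₁,x₂]` equals
`(x₂ − x₁)·a(u₁,u₂)`, where `a` is the nonlinear average. -/
theorem area_under_interpolant
    (f : ℝ → ℝ) (hf : ContDiff ℝ 2 f) (u₁ u₂ : ℝ) (h12 : u₁ < u₂)
    (hconv : ∀ v ∈ Set.Icc u₁ u₂, 0 < deriv (deriv f) v)
    (x₁ x₂ : ℝ) (hx : x₁ < x₂)
    (X : ℝ → ℝ)
    (hX : X = fun u => x₁ + ((deriv f u - deriv f u₁) / (deriv f u₂ - deriv f u₁)) * (x₂ - x₁))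
    (w : ℝ → ℝ)
    (hw_mem : ∀ x ∈ Set.Icc x₁ x₂, w x ∈ Set.Icc u₁ u₂)
    (hw_left : ∀ u ∈ Set.Icc u₁ u₂, w (X u) = u)
    (hw_right : ∀ x ∈ Set.Icc x₁ x₂, X (w x) = x) :
    ∫ x in x₁..x₂, w x =
      (x₂ - x₁) *
        (((deriv f u₂ * u₂ - f u₂) - (deriv f u₁ * u₁ - f u₁)) / (deriv f u₂ - deriv f u₁)) := by
  have hf1 : ContDiff ℝ 1 (deriv f) := by
    have h : ContDiff ℝ (1 + 1) f := by simpa [one_add_one_eq_two] using hf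
    exact (contDiff_succ_iff_deriv.1 h).2.2
  have hf2 : Continuous (deriv (deriv f)) := hf1.continuous_deriv le_rfl
  have hdf (u : ℝ) : HasDerivAt f (deriv f u) u :=
    (hf.differentiable two_ne_zero u).hasDerivAt
  have hddf (u : ℝ) : HasDerivAt (deriv f) (deriv (deriv f) u) u :=
    (hf1.differentiable one_ne_zero u).hasDerivAt
  have hmono : StrictMonoOn (deriv f) (Set.Icc u₁ u₂) :=
    strictMonoOn_of_deriv_pos (convex_Icc u₁ u₂) hf1.continuous.continuousOn
      fun v hv => hconv v (interior_subset hv)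
  have hd : 0 < deriv f u₂ - deriv f u₁ :=
    sub_pos.2 (hmono (Set.left_mem_Icc.2 h12.le) (Set.right_mem_Icc.2 h12.le) h12)
  set d := deriv f u₂ - deriv f u₁ with hd_def
  have hXderiv (u : ℝ) : HasDerivAt X (deriv (deriv f) u / d * (x₂ - x₁)) u := by
    rw [hX]
    exact ((((hddf u).sub_const _).div_const d).mul_const (x₂ - x₁)).const_add x₁
  have hX₁ : X u₁ = x₁ := by simp [hX]
  have hX₂ : X u₂ = x₂ := by simp [hX, ← hd_def, hd.ne']
  have hsubst : ∫ u in u₁..u₂, (w ∘ X) u * (deriv (deriv f) u / d * (x₂ - x₁)) =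
      ∫ x in x₁..x₂, w x := by
    conv_rhs => rw [← hX₁, ← hX₂]
    refine intervalIntegral.integral_comp_mul_deriv_of_deriv_nonneg
      (fun u _ => (hXderiv u).continuousAt.continuousWithinAt) (fun u _ => hXderiv u) ?_
    intro u hu
    rw [min_eq_left h12.le, max_eq_right h12.le] at hu
    exact mul_nonneg (div_nonneg (hconv u (Set.Ioo_subset_Icc_self hu)).le hd.le)
      (sub_nonneg.2 hx.le)
  have hleft : ∫ u in u₁..u₂, (w ∘ X) u * (deriv (deriv f) u / d * (x₂ - x₁)) =
      ∫ u in u₁..u₂, u * (deriv (deriv f) u / d * (x₂ - x₁)) := by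
    refine intervalIntegral.integral_congr fun u hu => ?_
    rw [Set.uIcc_of_le h12.le] at hu
    simp only [Function.comp_apply, hw_left u hu]
  have hprim (u : ℝ) : HasDerivAt (fun v => (x₂ - x₁) * ((deriv f v * v - f v) / d))
      (u * (deriv (deriv f) u / d * (x₂ - x₁))) u := by
    refine (((((hddf u).mul (hasDerivAt_id' u)).sub (hdf u)).div_const d).const_mul
      (x₂ - x₁)).congr_deriv ?_
    ring
  rw [← hsubst, hleft, intervalIntegral.integral_eq_sub_of_hasDerivAt (fun u _ => hprim u)
    (by apply Continuous.intervalIntegrable; fun_prop)]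
  ring
end

section
/- Let f : ℝ → ℝ be twice continuously differentiable, and let u₁ < u₂ with f''(v) > 0 for all v ∈ [u₁,u₂]. Then the nonlinear average is strictly bounded by its arguments: u₁ < a(u₁,u₂) < u₂. -/
/-- For a C² flux `f` with `f'' > 0` on `[u₁,u₂]` and `u₁ < u₂`,
the nonlinear average `a(u₁,u₂)` is strictly bounded by its arguments. -/
theorem nonlinear_average_strictly_between
    (f : ℝ → ℝ) (hf : ContDiff ℝ 2 f) (u₁ u₂ : ℝ) (h12 : u₁ < u₂)
    (hconv : ∀ v ∈ Set.Icc u₁ u₂, 0 < deriv (deriv f) v) :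
    u₁ < ((deriv f u₂ * u₂ - f u₂) - (deriv f u₁ * u₁ - f u₁)) / (deriv f u₂ - deriv f u₁) ∧
    ((deriv f u₂ * u₂ - f u₂) - (deriv f u₁ * u₁ - f u₁)) / (deriv f u₂ - deriv f u₁) < u₂ := by
  have hdiff : Differentiable ℝ f := hf.differentiable (by norm_num)
  have hcont : Continuous (deriv f) := hf.continuous_deriv (by norm_num)
  have hmono : StrictMonoOn (deriv f) (Set.Icc u₁ u₂) :=
    strictMonoOn_of_deriv_pos (convex_Icc u₁ u₂) hcont.continuousOn
      fun v hv => hconv v (interior_subset hv)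
  obtain ⟨c, hc, hslope⟩ :=
    exists_deriv_eq_slope f h12 hdiff.continuous.continuousOn hdiff.differentiableOn
  have hlen : 0 < u₂ - u₁ := sub_pos.2 h12
  have hleft : deriv f u₁ < deriv f c :=
    hmono (Set.left_mem_Icc.2 h12.le) (Set.Ioo_subset_Icc_self hc) hc.1
  have hright : deriv f c < deriv f u₂ :=
    hmono (Set.Ioo_subset_Icc_self hc) (Set.right_mem_Icc.2 h12.le) hc.2
  have hden : 0 < deriv f u₂ - deriv f u₁ := sub_pos.2 (hleft.trans hright)
  rw [hslope, lt_div_iff₀ hlen] at hleft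
  rw [hslope, div_lt_iff₀ hlen] at hright
  constructor
  · rw [lt_div_iff₀ hden]
    linarith
  · rw [div_lt_iff₀ hden]
    linarith
end

section
/- Let f : ℝ → ℝ be twice continuously differentiable and let J ⊆ ℝ be an interval with f''(v) > 0 for all v ∈ J. Extend the nonlinear average to the diagonal by setting a(w,w) = w. Then for every fixed u₁ ∈ J, the function u₂ ↦ a(u₁,u₂) is strictly increasing on J: if u₂, u₂' ∈ J with u₂ < u₂', then a(u₁,u₂) < a(u₁,u₂'). By the symmetry a(u₁,u₂) = a(u₂,u₁), the same holds in the first argument. -/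
/-- On an order-connected set where `f'' > 0`, the increment of `v ↦ f' v * v - f v` lies strictly
between `p` and `q` times the increment of `f'`. -/
theorem legendre_increment_bounds {f : ℝ → ℝ} (hf : ContDiff ℝ 2 f) {J : Set ℝ}
    (hJ : J.OrdConnected) (hconv : ∀ v ∈ J, 0 < deriv (deriv f) v) {p q : ℝ} (hp : p ∈ J)
    (hq : q ∈ J) (hpq : p < q) :
    deriv f p < deriv f q ∧
    p * (deriv f q - deriv f p) < (deriv f q * q - f q) - (deriv f p * p - f p) ∧
    (deriv f q * q - f q) - (deriv f p * p - f p) < q * (deriv f q - deriv f p) := by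
  have hmono : StrictMonoOn (deriv f) J :=
    strictMonoOn_of_deriv_pos hJ.convex (hf.continuous_deriv (by norm_num)).continuousOn
      fun v hv => hconv v (interior_subset hv)
  obtain ⟨c, hc, hfc⟩ := exists_deriv_eq_slope f hpq hf.continuous.continuousOn
    (hf.differentiable (by norm_num)).differentiableOn
  have hcJ : c ∈ J := hJ.out hp hq (Set.Ioo_subset_Icc_self hc)
  have hpc := hmono hp hcJ hc.1
  have hcq := hmono hcJ hq hc.2
  rw [eq_div_iff (sub_pos.2 hpq).ne'] at hfc
  refine ⟨hpc.trans hcq, ?_, ?_⟩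
  · nlinarith [mul_pos (sub_pos.2 hcq) (sub_pos.2 hpq)]
  · nlinarith [mul_pos (sub_pos.2 hpc) (sub_pos.2 hpq)]

/-- If the increments of `H` lie strictly between `p` and `q` times the increments of `g`, then the
ratio of increments, extended to the diagonal by the identity, is strictly increasing in its second
argument. -/
theorem increment_ratio_lt {g H : ℝ → ℝ} {J : Set ℝ}
    (h : ∀ p ∈ J, ∀ q ∈ J, p < q → g p < g q ∧ p * (g q - g p) < H q - H p ∧
      H q - H p < q * (g q - g p)) {w x y : ℝ} (hw : w ∈ J) (hx : x ∈ J) (hy : y ∈ J)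
    (hxy : x < y) :
    (if w = x then w else (H x - H w) / (g x - g w)) <
      if w = y then w else (H y - H w) / (g y - g w) := by
  have swap (q : ℝ) : (H q - H w) / (g q - g w) = (H w - H q) / (g w - g q) := by
    rw [← neg_sub (H w), ← neg_sub (g w), neg_div_neg_eq]
  obtain ⟨hgxy, hlxy, huxy⟩ := h x hx y hy hxy
  rcases lt_trichotomy w x with hwx | rfl | hxw
  · obtain ⟨hg, hl, hu⟩ := h w hw x hx hwx
    rw [if_neg hwx.ne, if_neg (hwx.trans hxy).ne,
      div_lt_div_iff₀ (by linarith) (by linarith)]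
    nlinarith [mul_pos (sub_pos.2 hu) (sub_pos.2 hgxy), mul_pos (sub_pos.2 hlxy) (sub_pos.2 hg)]
  · rw [if_pos rfl, if_neg hxy.ne, lt_div_iff₀ (by linarith)]
    exact hlxy
  · obtain ⟨hg, hl, hu⟩ := h x hx w hw hxw
    have hxlt : (H x - H w) / (g x - g w) < w := by
      rw [swap, div_lt_iff₀ (by linarith)]
      exact hu
    rw [if_neg hxw.ne']
    rcases lt_trichotomy w y with hwy | rfl | hyw
    · obtain ⟨hg', hl', hu'⟩ := h w hw y hy hwy
      rw [if_neg hwy.ne]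
      refine hxlt.trans ?_
      rw [lt_div_iff₀ (by linarith)]
      exact hl'
    · rwa [if_pos rfl]
    · obtain ⟨hg', hl', hu'⟩ := h y hy w hw hyw
      rw [if_neg hyw.ne', swap x, swap y, div_lt_div_iff₀ (by linarith) (by linarith)]
      nlinarith [mul_pos (sub_pos.2 huxy) (sub_pos.2 hg'),
        mul_pos (sub_pos.2 hl') (sub_pos.2 hgxy)]

/-- For a C² flux with `f'' > 0` on an interval `J`, the nonlinear average
(extended to the diagonal by `a(w,w) = w`) is strictly increasing in each argument on `J`. -/
theorem nonlinear_average_strictly_increasing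
    (f : ℝ → ℝ) (hf : ContDiff ℝ 2 f) (J : Set ℝ) (hJ : J.OrdConnected)
    (hconv : ∀ v ∈ J, 0 < deriv (deriv f) v)
    (a : ℝ → ℝ → ℝ)
    (ha : a = fun p q => if p = q then p else
      ((deriv f q * q - f q) - (deriv f p * p - f p)) / (deriv f q - deriv f p)) :
    (∀ u₁ ∈ J, ∀ u₂ ∈ J, ∀ u₂' ∈ J, u₂ < u₂' → a u₁ u₂ < a u₁ u₂') ∧
    (∀ u₂ ∈ J, ∀ u₁ ∈ J, ∀ u₁' ∈ J, u₁ < u₁' → a u₁ u₂ < a u₁' u₂) := by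
  have hinc (w x y : ℝ) (hw : w ∈ J) (hx : x ∈ J) (hy : y ∈ J) (hxy : x < y) :
      a w x < a w y := by
    subst ha
    exact increment_ratio_lt (g := deriv f) (H := fun v => deriv f v * v - f v)
      (fun p hp q hq hpq => legendre_increment_bounds hf hJ hconv hp hq hpq) hw hx hy hxy
  have hsymm (p q : ℝ) : a p q = a q p := by
    subst ha
    rcases eq_or_ne p q with rfl | hpq
    · rfl
    · simp only [if_neg hpq, if_neg hpq.symm]
      rw [← neg_sub (deriv f p * p - f p), ← neg_sub (deriv f p), neg_div_neg_eq]
  refine ⟨fun w hw x hx y hy => hinc w x y hw hx hy, fun w hw x hx y hy hxy => ?_⟩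
  rw [hsymm x, hsymm y]
  exact hinc w x y hw hx hy hxy
end

section
/- Let f : ℝ → ℝ be twice continuously differentiable and let v ∈ ℝ with f''(v) ≠ 0. Then the nonlinear average is continuous at the diagonal point (v,v): for u₂ ≠ v tending to v, a(v,u₂) = ((f'(u₂)·u₂ − f(u₂)) − (f'(v)·v − f(v))) / (f'(u₂) − f'(v)) tends to v. More generally, a(u₁,u₂) → v as (u₁,u₂) → (v,v) with u₁ ≠ u₂. -/
open Filter Topology

/-- If the second derivative `f''` has no zero in `(p, q)`, the nonlinear average of `p` and `q` lies
strictly between them: it is an intermediate point of Cauchy's mean value theorem. -/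
theorem nonlinear_average_mem_Ioo {f f' f'' : ℝ → ℝ} (hf : ∀ x, HasDerivAt f (f' x) x)
    (hf' : ∀ x, HasDerivAt f' (f'' x) x) {p q : ℝ} (hpq : p < q)
    (hne : ∀ x ∈ Set.Ioo p q, f'' x ≠ 0) :
    ((f' q * q - f q) - (f' p * p - f p)) / (f' q - f' p) ∈ Set.Ioo p q := by
  have hg (x : ℝ) : HasDerivAt (fun y => f' y * y - f y) (f'' x * x) x := by
    refine (((hf' x).mul (hasDerivAt_id' x)).sub (hf x)).congr_deriv ?_
    ring
  have hslope : f' q - f' p ≠ 0 := by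
    obtain ⟨c, hc, h⟩ := exists_hasDerivAt_eq_slope f' f'' hpq
      (fun x _ => (hf' x).continuousAt.continuousWithinAt) (fun x _ => hf' x)
    intro h0
    exact hne c hc (by rw [h, h0, zero_div])
  obtain ⟨c, hc, h⟩ := exists_ratio_hasDerivAt_eq_ratio_slope (fun y => f' y * y - f y)
    (fun x => f'' x * x) hpq (fun x _ => (hg x).continuousAt.continuousWithinAt)
    (fun x _ => hg x) f' f'' (fun x _ => (hf' x).continuousAt.continuousWithinAt)
    (fun x _ => hf' x)
  convert hc using 1
  rw [div_eq_iff hslope]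
  apply mul_right_cancel₀ (hne c hc)
  linear_combination -h

/-- For a C² flux with `f''(v) ≠ 0`, the nonlinear average
`a(u₁,u₂) = ((f'(u₂)u₂ − f(u₂)) − (f'(u₁)u₁ − f(u₁)))/(f'(u₂) − f'(u₁))` is continuous at
the diagonal point `(v,v)`: `a(v,u₂) → v` as `u₂ → v`, `u₂ ≠ v`, and more generally
`a(u₁,u₂) → v` as `(u₁,u₂) → (v,v)` with `u₁ ≠ u₂`. -/
theorem nonlinear_average_continuous_at_diagonal
    (f : ℝ → ℝ) (hf : ContDiff ℝ 2 f) (v : ℝ) (hv : deriv (deriv f) v ≠ 0)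
    (a : ℝ → ℝ → ℝ)
    (ha : a = fun p q =>
      ((deriv f q * q - f q) - (deriv f p * p - f p)) / (deriv f q - deriv f p)) :
    Tendsto (fun u₂ => a v u₂) (𝓝[≠] v) (𝓝 v) ∧
    Tendsto (fun p : ℝ × ℝ => a p.1 p.2)
      (𝓝[{p : ℝ × ℝ | p.1 ≠ p.2}] (v, v)) (𝓝 v) := by
  have hf₁ : ContDiff ℝ 1 (deriv f) := hf.deriv'
  have hd (x : ℝ) : HasDerivAt f (deriv f x) x :=
    (hf.differentiable (by norm_num) x).hasDerivAt
  have hd' (x : ℝ) : HasDerivAt (deriv f) (deriv (deriv f) x) x :=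
    (hf₁.differentiable one_ne_zero x).hasDerivAt
  have hsymm (p q : ℝ) : a p q = a q p := by
    simp only [ha]
    rw [← neg_div_neg_eq, neg_sub, neg_sub]
  have main : Tendsto (fun p : ℝ × ℝ => a p.1 p.2)
      (𝓝[{p : ℝ × ℝ | p.1 ≠ p.2}] (v, v)) (𝓝 v) := by
    obtain ⟨δ, hδ, hne⟩ := Metric.eventually_nhds_iff_ball.1
      ((hf₁.continuous_deriv le_rfl).continuousAt.eventually_ne hv)
    have key {ε p q : ℝ} (hε : ε ≤ δ) (hpq : p < q) (hp : p ∈ Metric.ball v ε)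
        (hq : q ∈ Metric.ball v ε) : a p q ∈ Metric.ball v ε := by
      have hsub : Set.Ioo p q ⊆ Metric.ball v ε :=
        Set.Ioo_subset_Icc_self.trans ((convex_ball v ε).ordConnected.out hp hq)
      rw [ha]
      exact hsub (nonlinear_average_mem_Ioo hd hd' hpq
        fun x hx => hne x (Metric.ball_subset_ball hε (hsub hx)))
    rw [Metric.tendsto_nhds]
    intro ε hε
    have hball : Metric.ball v (min ε δ) ×ˢ Metric.ball v (min ε δ) ∈ 𝓝 (v, v) :=
      prod_mem_nhds (Metric.ball_mem_nhds v (lt_min hε hδ)) (Metric.ball_mem_nhds v (lt_min hε hδ))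
    filter_upwards [self_mem_nhdsWithin, mem_nhdsWithin_of_mem_nhds hball]
    rintro ⟨p, q⟩ hpq ⟨hp, hq⟩
    apply Metric.ball_subset_ball (min_le_left ε δ)
    rcases lt_or_gt_of_ne hpq with h | h
    · exact key (min_le_right ε δ) h hp hq
    · rw [hsymm]
      exact key (min_le_right ε δ) h hq hp
  refine ⟨main.comp (f := fun u => (v, u)) (tendsto_nhdsWithin_iff.2 ⟨?_, ?_⟩), main⟩
  · exact (Continuous.prodMk_right v).continuousAt.tendsto.mono_left nhdsWithin_le_nhds
  · filter_upwards [self_mem_nhdsWithin] with x hx using Ne.symm hx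
end

section
/- Let f : ℝ → ℝ be twice continuously differentiable, let I ⊆ ℝ be an open time interval, and let u : ℝ × I → ℝ be a continuously differentiable classical solution of u_t + f'(u)·u_x = 0. Let u₁, u₂ ∈ ℝ and let x₁, x₂ : I → ℝ be characteristic trajectories: x₁'(t) = f'(u₁), x₂'(t) = f'(u₂), with u(x₁(t),t) = u₁ and u(x₂(t),t) = u₂ for all t ∈ I. Then the area between the two particles changes at the constant rate given by the Legendre transform F(v) = f'(v)·v − f(v) of the flux: d/dt ∫_{x₁(t)}^{x₂(t)} u(x,t) dx = F(u₂) − F(u₁) for all t ∈ I. -/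
open Set Filter Topology MeasureTheory

/-- Leibniz rule with fixed end points, for an integrand that is `C¹` on a strip. -/
theorem hasDerivAt_intervalIntegral_of_contDiffOn {u : ℝ → ℝ → ℝ} {I : Set ℝ} (hI : IsOpen I)
    (hu : ContDiffOn ℝ 1 (fun p : ℝ × ℝ => u p.1 p.2) (univ ×ˢ I)) (a b : ℝ) {t : ℝ}
    (ht : t ∈ I) :
    HasDerivAt (fun s => ∫ x in a..b, u x s)
      (∫ x in a..b, fderiv ℝ (fun p : ℝ × ℝ => u p.1 p.2) (x, t) (0, 1)) t := by
  have hopen : IsOpen ((univ : Set ℝ) ×ˢ I) := isOpen_univ.prod hI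
  have hcont : ContinuousOn
      (fun p : ℝ × ℝ => fderiv ℝ (fun p : ℝ × ℝ => u p.1 p.2) p (0, 1)) (univ ×ˢ I) :=
    (hu.continuousOn_fderiv_of_isOpen hopen le_rfl).clm_apply continuousOn_const
  have hslice : ∀ s : ℝ, Continuous fun x : ℝ => (x, s) := fun s => by fun_prop
  have hu_slice : ∀ s ∈ I, Continuous fun x => u x s := fun s hs =>
    hu.continuousOn.comp_continuous (hslice s) fun x => ⟨mem_univ x, hs⟩
  obtain ⟨δ, hδ, hball⟩ := Metric.nhds_basis_closedBall.mem_iff.1 (hI.mem_nhds ht)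
  obtain ⟨C, hC⟩ := (isCompact_uIcc.prod (isCompact_closedBall t δ)).exists_bound_of_continuousOn
    (hcont.mono (prod_mono (subset_univ (uIcc a b)) hball))
  refine (intervalIntegral.hasDerivAt_integral_of_dominated_loc_of_deriv_le
    (F := fun s x => u x s)
    (F' := fun s x => fderiv ℝ (fun p : ℝ × ℝ => u p.1 p.2) (x, s) (0, 1))
    (bound := fun _ => C) (Metric.closedBall_mem_nhds t hδ) ?_ ?_ ?_ ?_ ?_ ?_).2
  · filter_upwards [hI.mem_nhds ht] with s hs
    exact (hu_slice s hs).aestronglyMeasurable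
  · exact (hu_slice t ht).intervalIntegrable a b
  · exact (hcont.comp_continuous (hslice t) fun x => ⟨mem_univ x, ht⟩).aestronglyMeasurable
  · exact .of_forall fun x hx s hs => hC (x, s) ⟨uIoc_subset_uIcc hx, hs⟩
  · exact intervalIntegrable_const
  · refine .of_forall fun x _ s hs => ?_
    have hd : HasFDerivAt (fun p : ℝ × ℝ => u p.1 p.2) _ (x, s) :=
      ((hu.differentiableOn one_ne_zero).differentiableAt
        (hopen.mem_nhds ⟨mem_univ x, hball hs⟩)).hasFDerivAt
    exact hd.comp_hasDerivAt s ((hasDerivAt_const s x).prodMk (hasDerivAt_id s))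

/-- The contribution of a moving end point to the Leibniz rule. -/
theorem hasDerivAt_intervalIntegral_of_moving_endpoint {u : ℝ → ℝ → ℝ} {y : ℝ → ℝ} {t y' : ℝ}
    (hu : ContinuousAt (fun p : ℝ × ℝ => u p.1 p.2) (y t, t))
    (hint : ∀ᶠ s in 𝓝 t, Continuous fun x => u x s) (hy : HasDerivAt y y' t) :
    HasDerivAt (fun s => ∫ x in y t..y s, u x s) (y' * u (y t) t) t := by
  have hrem : HasDerivAt (fun s => ∫ x in y t..y s, (u x s - u (y t) t)) 0 t := by
    rw [hasDerivAt_iff_isLittleO]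
    suffices h : (fun s => ∫ x in y t..y s, (u x s - u (y t) t)) =o[𝓝 t] fun s => y s - y t by
      simpa using h.trans_isBigO hy.isBigO_sub
    refine Asymptotics.isLittleO_iff.2 fun ε hε => ?_
    obtain ⟨δ, hδ, hball⟩ := Metric.continuousAt_iff.1 hu ε hε
    filter_upwards [hy.continuousAt (Metric.ball_mem_nhds _ hδ), Metric.ball_mem_nhds t hδ]
      with s hys hs
    refine intervalIntegral.norm_integral_le_of_norm_le_const fun x hx => ?_
    rw [← dist_eq_norm]
    refine (hball (x := (x, s)) ?_).le
    rw [dist_comm, Prod.dist_eq]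
    exact max_lt ((Real.dist_left_le_of_mem_uIcc (uIoc_subset_uIcc hx)).trans_lt
      (by rwa [dist_comm])) (by rwa [dist_comm])
  have hsum := hrem.add ((hy.sub_const (y t)).mul_const (u (y t) t))
  rw [zero_add] at hsum
  refine hsum.congr_of_eventuallyEq ?_
  filter_upwards [hint] with s hs
  simp [intervalIntegral.integral_sub (hs.intervalIntegrable _ _) intervalIntegrable_const]

/-- For a classical solution `u` of `u_t + f'(u)·u_x = 0` and characteristic
trajectories `x₁, x₂` carrying the constant values `u₁, u₂`, the area between the two
particles changes at the constant rate `F(u₂) − F(u₁)`, where `F(v) = f'(v)·v − f(v)`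
is the Legendre transform of the flux. -/
theorem area_evolution_legendre_flux
    (f : ℝ → ℝ) (hf : ContDiff ℝ 2 f)
    (I : Set ℝ) (hIopen : IsOpen I) (hIconn : I.OrdConnected)
    (u : ℝ → ℝ → ℝ)
    (hu : ContDiffOn ℝ 1 (fun p : ℝ × ℝ => u p.1 p.2) (Set.univ ×ˢ I))
    (hpde : ∀ x : ℝ, ∀ t ∈ I,
      ∃ ut ux : ℝ,
        HasDerivAt (fun s => u x s) ut t ∧
        HasDerivAt (fun y => u y t) ux x ∧
        ut + deriv f (u x t) * ux = 0)
    (u₁ u₂ : ℝ) (x₁ x₂ : ℝ → ℝ)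
    (hx₁ : ∀ t ∈ I, HasDerivAt x₁ (deriv f u₁) t)
    (hx₂ : ∀ t ∈ I, HasDerivAt x₂ (deriv f u₂) t)
    (hu₁ : ∀ t ∈ I, u (x₁ t) t = u₁)
    (hu₂ : ∀ t ∈ I, u (x₂ t) t = u₂) :
    ∀ t ∈ I,
      HasDerivAt (fun s => ∫ x in x₁ s..x₂ s, u x s)
        ((deriv f u₂ * u₂ - f u₂) - (deriv f u₁ * u₁ - f u₁)) t := by
  intro t ht
  have hopen : IsOpen ((univ : Set ℝ) ×ˢ I) := isOpen_univ.prod hIopen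
  have hu_slice : ∀ s ∈ I, Continuous fun x => u x s := fun s hs =>
    hu.continuousOn.comp_continuous (by fun_prop : Continuous fun x : ℝ => (x, s))
      fun x => ⟨mem_univ x, hs⟩
  have hu_at : ∀ x, ContinuousAt (fun p : ℝ × ℝ => u p.1 p.2) (x, t) := fun x =>
    hu.continuousOn.continuousAt (hopen.mem_nhds ⟨mem_univ x, ht⟩)
  have hev : ∀ᶠ s in 𝓝 t, Continuous fun x => u x s := by
    filter_upwards [hIopen.mem_nhds ht] with s hs using hu_slice s hs
  have hflux : ∀ x, HasDerivAt (fun y => -f (u y t))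
      (fderiv ℝ (fun p : ℝ × ℝ => u p.1 p.2) (x, t) (0, 1)) x := by
    intro x
    obtain ⟨ut, ux, hut, hux, heq⟩ := hpde x t ht
    have hd : HasFDerivAt (fun p : ℝ × ℝ => u p.1 p.2) _ (x, t) :=
      ((hu.differentiableOn one_ne_zero).differentiableAt
        (hopen.mem_nhds ⟨mem_univ x, ht⟩)).hasFDerivAt
    have hdt : HasDerivAt (fun s => u x s) _ t :=
      hd.comp_hasDerivAt t ((hasDerivAt_const t x).prodMk (hasDerivAt_id t))
    have hf_at := (hf.differentiable two_ne_zero (u x t)).hasDerivAt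
    rw [hdt.unique hut, eq_neg_of_add_eq_zero_left heq]
    exact (hf_at.comp x hux).neg
  have hfixed := hasDerivAt_intervalIntegral_of_contDiffOn hIopen hu (x₁ t) (x₂ t) ht
  rw [intervalIntegral.integral_eq_sub_of_hasDerivAt (fun x _ => hflux x)
    (Continuous.intervalIntegrable
      (((hu.continuousOn_fderiv_of_isOpen hopen le_rfl).clm_apply
        continuousOn_const).comp_continuous (by fun_prop : Continuous fun x : ℝ => (x, t))
          fun x => ⟨mem_univ x, ht⟩) _ _), hu₁ t ht, hu₂ t ht] at hfixed
  have hleft := hasDerivAt_intervalIntegral_of_moving_endpoint (hu_at _) hev (hx₁ t ht)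
  have hright := hasDerivAt_intervalIntegral_of_moving_endpoint (hu_at _) hev (hx₂ t ht)
  rw [hu₁ t ht] at hleft
  rw [hu₂ t ht] at hright
  refine (((hfixed.add hright).sub hleft).congr_of_eventuallyEq ?_).congr_deriv (by ring)
  filter_upwards [hev] with s hs
  have hi := fun a b => hs.intervalIntegrable (μ := volume) a b
  simp only [Pi.add_apply, Pi.sub_apply]
  rw [intervalIntegral.integral_add_adjacent_intervals (hi _ _) (hi _ _), eq_sub_iff_add_eq,
    add_comm, intervalIntegral.integral_add_adjacent_intervals (hi _ _) (hi _ _)]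
end

section
/- Let f : ℝ → ℝ be twice continuously differentiable with f''(v) > 0 for all v in an interval J containing u₁, u₂, u₃, u₄, where u₂ > u₃ (two colliding particles). Let x₁ < x₂₃ < x₄ be real numbers (the merged particle is placed at x₂₃, with the colliding pair located at x₂ = x₃ = x₂₃). Extend the nonlinear average by a(w,w) = w. Then there exists a unique value v ∈ [u₃, u₂] satisfying the area-conservation condition for merging: (x₂₃ − x₁)·a(u₁, v) + (x₄ − x₂₃)·a(v, u₄) = (x₂₃ − x₁)·a(u₁, u₂) + (x₄ − x₂₃)·a(u₃, u₄). -/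
/-- The nonlinear average associated with a flux `f`, extended to the diagonal by `a(w, w) = w`. -/
noncomputable def nonlinearAverage (f : ℝ → ℝ) (p q : ℝ) : ℝ :=
  if p = q then p else
    ((deriv f q * q - f q) - (deriv f p * p - f p)) / (deriv f q - deriv f p)

namespace nonlinearAverage

variable {f : ℝ → ℝ} {J : Set ℝ} {p q r : ℝ}

theorem self (f : ℝ → ℝ) (p : ℝ) : nonlinearAverage f p p = p := if_pos rfl

theorem of_ne (h : p ≠ q) : nonlinearAverage f p q =
    ((deriv f q * q - f q) - (deriv f p * p - f p)) / (deriv f q - deriv f p) := if_neg h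

theorem comm (f : ℝ → ℝ) (p q : ℝ) : nonlinearAverage f p q = nonlinearAverage f q p := by
  rcases eq_or_ne p q with rfl | h
  · rfl
  · rw [of_ne h, of_ne h.symm, ← neg_div_neg_eq, neg_sub, neg_sub]

/-- The secant slope lies strictly between the derivatives at the endpoints. -/
theorem secant_bounds (hf : Differentiable ℝ f) (hJ : J.OrdConnected)
    (hmono : StrictMonoOn (deriv f) J) (hp : p ∈ J) (hq : q ∈ J) (hpq : p < q) :
    deriv f p * (q - p) < f q - f p ∧ f q - f p < deriv f q * (q - p) := by
  obtain ⟨ξ, hξ, h⟩ := exists_deriv_eq_slope f hpq hf.continuous.continuousOn hf.differentiableOn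
  have hpq' : 0 < q - p := sub_pos.2 hpq
  have hξJ : ξ ∈ J := hJ.out hp hq (Set.Ioo_subset_Icc_self hξ)
  rw [eq_div_iff hpq'.ne'] at h
  rw [← h]
  exact ⟨mul_lt_mul_of_pos_right (hmono hp hξJ hξ.1) hpq',
    mul_lt_mul_of_pos_right (hmono hξJ hq hξ.2) hpq'⟩

theorem mem_Ioo (hf : Differentiable ℝ f) (hJ : J.OrdConnected)
    (hmono : StrictMonoOn (deriv f) J) (hp : p ∈ J) (hq : q ∈ J) (hpq : p < q) :
    nonlinearAverage f p q ∈ Set.Ioo p q := by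
  have hD : 0 < deriv f q - deriv f p := sub_pos.2 (hmono hp hq hpq)
  obtain ⟨hl, hu⟩ := secant_bounds hf hJ hmono hp hq hpq
  rw [of_ne hpq.ne, Set.mem_Ioo, lt_div_iff₀ hD, div_lt_iff₀ hD]
  constructor <;> linarith

/-- The average over `[p, r]` is a mediant of the averages over `[p, q]` and `[q, r]`. -/
theorem lt_and_lt_of_lt_of_lt (hf : Differentiable ℝ f) (hJ : J.OrdConnected)
    (hmono : StrictMonoOn (deriv f) J) (hp : p ∈ J) (hq : q ∈ J) (hr : r ∈ J)
    (hpq : p < q) (hqr : q < r) :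
    nonlinearAverage f p q < nonlinearAverage f p r ∧
      nonlinearAverage f p r < nonlinearAverage f q r := by
  have hD₁ : 0 < deriv f q - deriv f p := sub_pos.2 (hmono hp hq hpq)
  have hD₂ : 0 < deriv f r - deriv f q := sub_pos.2 (hmono hq hr hqr)
  have hD : 0 < deriv f r - deriv f p := by linarith
  have h₁ := (mem_Ioo hf hJ hmono hp hq hpq).2
  have h₂ := (mem_Ioo hf hJ hmono hq hr hqr).1
  have e₁ := (div_eq_iff hD₁.ne').1 (of_ne (f := f) hpq.ne).symm
  have e₂ := (div_eq_iff hD₂.ne').1 (of_ne (f := f) hqr.ne).symm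
  have h₃ := mul_lt_mul_of_pos_right (h₁.trans h₂) hD₁
  have h₄ := mul_lt_mul_of_pos_right (h₁.trans h₂) hD₂
  rw [of_ne (hpq.trans hqr).ne, lt_div_iff₀ hD, div_lt_iff₀ hD]
  constructor <;> linarith

theorem strictMonoOn (hf : Differentiable ℝ f) (hJ : J.OrdConnected)
    (hmono : StrictMonoOn (deriv f) J) (hp : p ∈ J) :
    StrictMonoOn (nonlinearAverage f p) J := by
  intro v hv w hw hvw
  rcases lt_trichotomy p v with h | rfl | h
  · exact (lt_and_lt_of_lt_of_lt hf hJ hmono hp hv hw h hvw).1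
  · rw [self]
    exact (mem_Ioo hf hJ hmono hp hw hvw).1
  · have hvp : nonlinearAverage f p v < p := by
      rw [comm]
      exact (mem_Ioo hf hJ hmono hv hp h).2
    rcases lt_trichotomy p w with h' | rfl | h'
    · exact hvp.trans (mem_Ioo hf hJ hmono hp hw h').1
    · rwa [self]
    · rw [comm f p v, comm f p w]
      exact (lt_and_lt_of_lt_of_lt hf hJ hmono hv hw hp hvw h').2

theorem mem_Icc_min_max (hf : Differentiable ℝ f) (hJ : J.OrdConnected)
    (hmono : StrictMonoOn (deriv f) J) (hp : p ∈ J) (hq : q ∈ J) :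
    nonlinearAverage f p q ∈ Set.Icc (min p q) (max p q) := by
  rcases lt_trichotomy p q with h | rfl | h
  · rw [min_eq_left h.le, max_eq_right h.le]
    exact Set.Ioo_subset_Icc_self (mem_Ioo hf hJ hmono hp hq h)
  · simp [self]
  · rw [min_eq_right h.le, max_eq_left h.le, comm]
    exact Set.Ioo_subset_Icc_self (mem_Ioo hf hJ hmono hq hp h)

theorem continuousOn (hf : Differentiable ℝ f) (hf' : Continuous (deriv f)) (hJ : J.OrdConnected)
    (hmono : StrictMonoOn (deriv f) J) (hp : p ∈ J) :
    ContinuousOn (nonlinearAverage f p) J := by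
  intro v hv
  rcases eq_or_ne p v with rfl | h
  · have hmin : Filter.Tendsto (fun q => min p q) (nhdsWithin p J) (nhds p) := by
      have h : Continuous fun q => min p q := by fun_prop
      simpa using (h.continuousWithinAt (s := J) (x := p)).tendsto
    have hmax : Filter.Tendsto (fun q => max p q) (nhdsWithin p J) (nhds p) := by
      have h : Continuous fun q => max p q := by fun_prop
      simpa using (h.continuousWithinAt (s := J) (x := p)).tendsto
    rw [ContinuousWithinAt, self]
    refine tendsto_of_tendsto_of_tendsto_of_le_of_le' hmin hmax ?_ ?_ <;>
      filter_upwards [self_mem_nhdsWithin] with q hq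
    · exact (mem_Icc_min_max hf hJ hmono hp hq).1
    · exact (mem_Icc_min_max hf hJ hmono hp hq).2
  · have hD : deriv f v - deriv f p ≠ 0 := sub_ne_zero.2 fun e => h (hmono.injOn hv hp e).symm
    have hfc := hf.continuous
    have hc : ContinuousAt (fun q => ((deriv f q * q - f q) - (deriv f p * p - f p)) /
        (deriv f q - deriv f p)) v :=
      ContinuousAt.div (by fun_prop) (by fun_prop) hD
    refine (hc.congr ?_).continuousWithinAt
    filter_upwards [isOpen_ne.mem_nhds h.symm] with q hq
    exact (of_ne (Ne.symm hq)).symm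

end nonlinearAverage

/-- Existence and uniqueness of the merged particle value. For a convex C²
flux and colliding particles with values `u₂ > u₃` at the common position `x₂₃`, with
neighbors at `x₁ < x₂₃ < x₄` carrying values `u₁, u₄`, there is a unique
`v ∈ [u₃, u₂]` conserving the total area under the piecewise similarity interpolant. -/
theorem merging_value_exists_unique
    (f : ℝ → ℝ) (hf : ContDiff ℝ 2 f)
    (J : Set ℝ) (hJ : J.OrdConnected)
    (hconv : ∀ w ∈ J, 0 < deriv (deriv f) w)
    (u₁ u₂ u₃ u₄ : ℝ) (h₁ : u₁ ∈ J) (h₂ : u₂ ∈ J) (h₃ : u₃ ∈ J) (h₄ : u₄ ∈ J)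
    (h23 : u₃ < u₂)
    (x₁ x₂₃ x₄ : ℝ) (hx₁ : x₁ < x₂₃) (hx₄ : x₂₃ < x₄)
    (a : ℝ → ℝ → ℝ)
    (ha : a = fun p q => if p = q then p else
      ((deriv f q * q - f q) - (deriv f p * p - f p)) / (deriv f q - deriv f p)) :
    ∃! v : ℝ, v ∈ Set.Icc u₃ u₂ ∧
      (x₂₃ - x₁) * a u₁ v + (x₄ - x₂₃) * a v u₄
        = (x₂₃ - x₁) * a u₁ u₂ + (x₄ - x₂₃) * a u₃ u₄ := by
  obtain rfl : a = nonlinearAverage f := ha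
  have hdiff : Differentiable ℝ f := hf.differentiable (by norm_num)
  have hf' : Continuous (deriv f) := hf.continuous_deriv (by norm_num)
  have hmono : StrictMonoOn (deriv f) J :=
    strictMonoOn_of_deriv_pos hJ.convex hf'.continuousOn
      fun w hw => hconv w (interior_subset hw)
  have hsub : Set.Icc u₃ u₂ ⊆ J := hJ.out h₃ h₂
  have hc : 0 < x₂₃ - x₁ := sub_pos.2 hx₁
  have hd : 0 < x₄ - x₂₃ := sub_pos.2 hx₄
  have hM₁ := nonlinearAverage.strictMonoOn hdiff hJ hmono h₁
  have hM₄ := nonlinearAverage.strictMonoOn hdiff hJ hmono h₄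
  have hC₁ := nonlinearAverage.continuousOn hdiff hf' hJ hmono h₁
  have hC₄ := nonlinearAverage.continuousOn hdiff hf' hJ hmono h₄
  simp only [fun v => nonlinearAverage.comm f v u₄]
  have hmonoArea : StrictMonoOn (fun v => (x₂₃ - x₁) * nonlinearAverage f u₁ v +
      (x₄ - x₂₃) * nonlinearAverage f u₄ v) J := fun v hv w hw hvw =>
    add_lt_add (mul_lt_mul_of_pos_left (hM₁ hv hw hvw) hc)
      (mul_lt_mul_of_pos_left (hM₄ hv hw hvw) hd)
  have hcontArea : ContinuousOn (fun v => (x₂₃ - x₁) * nonlinearAverage f u₁ v +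
      (x₄ - x₂₃) * nonlinearAverage f u₄ v) (Set.Icc u₃ u₂) :=
    ((continuousOn_const.mul hC₁).add (continuousOn_const.mul hC₄)).mono hsub
  obtain ⟨v, hv, hveq⟩ := intermediate_value_Icc h23.le hcontArea
    ⟨add_le_add_left (mul_le_mul_of_nonneg_left (hM₁ h₃ h₂ h23).le hc.le) _,
      add_le_add_right (mul_le_mul_of_nonneg_left (hM₄ h₃ h₂ h23).le hd.le) _⟩
  exact ⟨v, ⟨hv, hveq⟩, fun w hw =>
    hmonoArea.injOn (hsub hw.1) (hsub hv) (hw.2.trans hveq.symm)⟩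
end

section
/- Let f : ℝ → ℝ be twice continuously differentiable with f''(v) > 0 for all v in an interval containing u₁, u₂, u₃, u₄ and v₀. Let x₁ < x₂ < x₄ with x₃ = x₂ (a shock configuration), assume u₂ > u₃, u₁ ≠ u₂, u₃ ≠ u₄, v₀ ≠ u₁, v₀ ≠ u₄. Define the before-merge function w_b : [x₁,x₄] → ℝ by letting it equal, on [x₁,x₂], the inverse of the similarity interpolant from (x₁,u₁) to (x₂,u₂), and on [x₂,x₄] the inverse of the similarity interpolant from (x₂,u₃) to (x₄,u₄); define the after-merge function w_a : [x₁,x₄] → ℝ analogously with the interpolants from (x₁,u₁) to (x₂,v₀) and from (x₂,v₀) to (x₄,u₄). Assume area conservation: ∫_{x₁}^{x₄} w_a(x) dx = ∫_{x₁}^{x₄} w_b(x) dx, and the entropy-fix condition u₁ ≥ v₀ ≥ u₄. Then for every k ∈ ℝ the Kružkov entropy does not increase under the merge: ∫_{x₁}^{x₄} |w_a(x) − k| dx ≤ ∫_{x₁}^{x₄} |w_b(x) − k| dx. -/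
open MeasureTheory Set

theorem affine_of_similarity {a : ℝ → ℝ} {p q y z x v : ℝ} (hpq : a p ≠ a q) (hyz : y < z)
    (h : y + ((a v - a p) / (a q - a p)) * (z - y) = x) :
    a v = a p + (x - y) / (z - y) * (a q - a p) := by
  have h1 : a q - a p ≠ 0 := sub_ne_zero.2 hpq.symm
  have h2 : z - y ≠ 0 := (sub_pos.2 hyz).ne'
  subst h
  field_simp
  ring

theorem integrableOn_of_similarity {a : ℝ → ℝ} {J s : Set ℝ} (hJ : J.OrdConnected)
    (ha : StrictMonoOn a J) {p q y z : ℝ} (hp : p ∈ J) (hq : q ∈ J) (hpq : p ≠ q) (hyz : y < z)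
    {w : ℝ → ℝ} (hs : MeasurableSet s) (hfin : volume s ≠ ⊤)
    (hw : ∀ x ∈ s, w x ∈ uIcc p q ∧ y + ((a (w x) - a p) / (a q - a p)) * (z - y) = x) :
    IntegrableOn w s := by
  have hsub : uIcc p q ⊆ J := hJ.uIcc_subset hp hq
  have hne : a p ≠ a q := fun h => hpq (ha.injOn hp hq h)
  have hval : ∀ x ∈ s, a (w x) = a p + (x - y) / (z - y) * (a q - a p) :=
    fun x hx => affine_of_similarity hne hyz (hw x hx).2
  have hmeas : AEMeasurable w (volume.restrict s) := by
    rcases le_total (a p) (a q) with hle | hle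
    · refine aemeasurable_restrict_of_monotoneOn hs fun x hx x' hx' hxx => ?_
      rw [← ha.le_iff_le (hsub (hw x hx).1) (hsub (hw x' hx').1), hval x hx, hval x' hx']
      have : (x - y) / (z - y) ≤ (x' - y) / (z - y) :=
        div_le_div_of_nonneg_right (by linarith) (by linarith)
      linarith [mul_le_mul_of_nonneg_right this (sub_nonneg.2 hle)]
    · refine aemeasurable_restrict_of_antitoneOn hs fun x hx x' hx' hxx => ?_
      rw [← ha.le_iff_le (hsub (hw x' hx').1) (hsub (hw x hx).1), hval x hx, hval x' hx']
      have : (x - y) / (z - y) ≤ (x' - y) / (z - y) :=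
        div_le_div_of_nonneg_right (by linarith) (by linarith)
      linarith [mul_le_mul_of_nonpos_right this (sub_nonpos.2 hle)]
  refine IntegrableOn.of_bound (C := |p| + |q|) hfin.lt_top hmeas.aestronglyMeasurable ?_
  filter_upwards [ae_restrict_mem hs] with x hx
  obtain ⟨h1, h2⟩ := (hw x hx).1
  rw [Real.norm_eq_abs, abs_le]
  constructor
  · refine le_trans ?_ h1
    refine le_min ?_ ?_ <;> linarith [neg_abs_le p, neg_abs_le q, abs_nonneg p, abs_nonneg q]
  · refine h2.trans ?_
    refine max_le ?_ ?_ <;> linarith [le_abs_self p, le_abs_self q, abs_nonneg p, abs_nonneg q]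

theorem intervalIntegrable_of_Ico_Icc {w : ℝ → ℝ} {x y z : ℝ} (hxy : x ≤ y) (hyz : y ≤ z)
    (h1 : IntegrableOn w (Ico x y)) (h2 : IntegrableOn w (Icc y z)) :
    IntervalIntegrable w volume x z := by
  rw [intervalIntegrable_iff_integrableOn_Icc_of_le (hxy.trans hyz),
    ← Ico_union_Icc_eq_Icc hxy hyz]
  exact h1.union h2

theorem integral_lt_of_le_of_lt_Ioo {g h : ℝ → ℝ} {x y z : ℝ} (hxy : x < y) (hyz : y ≤ z)
    (hg : IntervalIntegrable g volume x z) (hh : IntervalIntegrable h volume x z)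
    (hle : ∀ t ∈ Icc x z, g t ≤ h t) (hlt : ∀ t ∈ Ioo x y, g t < h t) :
    ∫ t in x..z, g t < ∫ t in x..z, h t := by
  refine intervalIntegral.integral_lt_integral_of_ae_le_of_measure_setOfPred_lt_ne_zero
    (hxy.le.trans hyz) hg hh ?_ ?_
  · filter_upwards [ae_restrict_mem measurableSet_Ioc] with t ht
    exact hle t (Ioc_subset_Icc_self ht)
  · have hsub : Ioo x y ⊆ {t | g t < h t} := hlt
    have hsub' : Ioo x y ⊆ Ioc x z := fun t ht => ⟨ht.1, ht.2.le.trans hyz⟩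
    have hpos : 0 < (volume.restrict (Ioc x z)) (Ioo x y) := by
      rw [Measure.restrict_apply measurableSet_Ioo, inter_eq_left.2 hsub',
        Real.volume_Ioo]
      simpa using hxy
    exact (hpos.trans_le (measure_mono hsub)).ne'

/-- Kružkov entropies decrease when the two profiles have equal area and, relative to a splitting
value `v`, the profile `h` is further from `v` on the same side as `g`. -/
theorem integral_abs_sub_le_of_splitting {g h : ℝ → ℝ} {x z v : ℝ} (hxz : x ≤ z)
    (hg : IntervalIntegrable g volume x z) (hh : IntervalIntegrable h volume x z)
    (harea : ∫ t in x..z, g t = ∫ t in x..z, h t)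
    (hsplit : ∀ t ∈ Icc x z, (v ≤ g t ∧ g t ≤ h t) ∨ (g t ≤ v ∧ h t ≤ g t)) (k : ℝ) :
    ∫ t in x..z, |g t - k| ≤ ∫ t in x..z, |h t - k| := by
  have hgk := hg.sub (intervalIntegrable_const (c := k))
  have hhk := hh.sub (intervalIntegrable_const (c := k))
  rcases le_total v k with hk | hk
  · have key : ∫ t in x..z, (|g t - k| + g t) ≤ ∫ t in x..z, (|h t - k| + h t) := by
      refine intervalIntegral.integral_mono_on hxz (hgk.abs.add hg) (hhk.abs.add hh) ?_
      intro t ht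
      rcases hsplit t ht with ⟨h1, h2⟩ | ⟨h1, h2⟩
      · grind
      · rw [abs_of_nonpos (by linarith), abs_of_nonpos (by linarith)]
        linarith
    rw [intervalIntegral.integral_add hgk.abs hg, intervalIntegral.integral_add hhk.abs hh] at key
    linarith
  · have key : ∫ t in x..z, (|g t - k| - g t) ≤ ∫ t in x..z, (|h t - k| - h t) := by
      refine intervalIntegral.integral_mono_on hxz (hgk.abs.sub hg) (hhk.abs.sub hh) ?_
      intro t ht
      rcases hsplit t ht with ⟨h1, h2⟩ | ⟨h1, h2⟩
      · rw [abs_of_nonneg (by linarith), abs_of_nonneg (by linarith)]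
        linarith
      · grind
    rw [intervalIntegral.integral_sub hgk.abs hg, intervalIntegral.integral_sub hhk.abs hh] at key
    linarith


/-- Entropy diminishing property of particle merging. If the merged value
`v₀` satisfies the entropy-fix condition `u₁ ≥ v₀ ≥ u₄`, and the merge conserves area,
then for every `k` the Kružkov entropy `∫ |w − k| dx` does not increase when the
before-merge profile `w_b` (piecewise inverse similarity interpolants through
`(x₁,u₁),(x₂,u₂)` and `(x₂,u₃),(x₄,u₄)`) is replaced by the after-merge profile `w_a`
(through `(x₁,u₁),(x₂,v₀)` and `(x₂,v₀),(x₄,u₄)`). -/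
theorem merging_entropy_diminishing
    (f : ℝ → ℝ) (hf : ContDiff ℝ 2 f)
    (J : Set ℝ) (hJ : J.OrdConnected)
    (hconv : ∀ v ∈ J, 0 < deriv (deriv f) v)
    (u₁ u₂ u₃ u₄ v₀ : ℝ)
    (h₁ : u₁ ∈ J) (h₂ : u₂ ∈ J) (h₃ : u₃ ∈ J) (h₄ : u₄ ∈ J) (h₀ : v₀ ∈ J)
    (h23 : u₃ < u₂) (h12 : u₁ ≠ u₂) (h34 : u₃ ≠ u₄) (hv1 : v₀ ≠ u₁) (hv4 : v₀ ≠ u₄)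
    (x₁ x₂ x₄ : ℝ) (hx12 : x₁ < x₂) (hx24 : x₂ < x₄)
    (w_b w_a : ℝ → ℝ)
    (hwb_left : ∀ x ∈ Set.Ico x₁ x₂, w_b x ∈ Set.uIcc u₁ u₂ ∧
      x₁ + ((deriv f (w_b x) - deriv f u₁) / (deriv f u₂ - deriv f u₁)) * (x₂ - x₁) = x)
    (hwb_right : ∀ x ∈ Set.Icc x₂ x₄, w_b x ∈ Set.uIcc u₃ u₄ ∧
      x₂ + ((deriv f (w_b x) - deriv f u₃) / (deriv f u₄ - deriv f u₃)) * (x₄ - x₂) = x)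
    (hwa_left : ∀ x ∈ Set.Ico x₁ x₂, w_a x ∈ Set.uIcc u₁ v₀ ∧
      x₁ + ((deriv f (w_a x) - deriv f u₁) / (deriv f v₀ - deriv f u₁)) * (x₂ - x₁) = x)
    (hwa_right : ∀ x ∈ Set.Icc x₂ x₄, w_a x ∈ Set.uIcc v₀ u₄ ∧
      x₂ + ((deriv f (w_a x) - deriv f v₀) / (deriv f u₄ - deriv f v₀)) * (x₄ - x₂) = x)
    (harea : ∫ x in x₁..x₄, w_a x = ∫ x in x₁..x₄, w_b x)
    (hfix₁ : u₄ ≤ v₀) (hfix₂ : v₀ ≤ u₁) :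
    ∀ k : ℝ, ∫ x in x₁..x₄, |w_a x - k| ≤ ∫ x in x₁..x₄, |w_b x - k| := by
  intro k
  have ha : StrictMonoOn (deriv f) J :=
    strictMonoOn_of_deriv_pos hJ.convex (hf.continuous_deriv (by norm_num)).continuousOn
      fun v hv => hconv v (interior_subset hv)
  have hne : ∀ {p q}, p ∈ J → q ∈ J → p ≠ q → deriv f p ≠ deriv f q :=
    fun hp hq hpq h => hpq (ha.injOn hp hq h)
  have hx14 : x₁ < x₄ := hx12.trans hx24
  have hIb : IntervalIntegrable w_b volume x₁ x₄ :=
    intervalIntegrable_of_Ico_Icc hx12.le hx24.le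
      (integrableOn_of_similarity hJ ha h₁ h₂ h12 hx12 measurableSet_Ico (by simp) hwb_left)
      (integrableOn_of_similarity hJ ha h₃ h₄ h34 hx24 measurableSet_Icc (by simp) hwb_right)
  have hIa : IntervalIntegrable w_a volume x₁ x₄ :=
    intervalIntegrable_of_Ico_Icc hx12.le hx24.le
      (integrableOn_of_similarity hJ ha h₁ h₀ hv1.symm hx12 measurableSet_Ico (by simp) hwa_left)
      (integrableOn_of_similarity hJ ha h₀ h₄ hv4 hx24 measurableSet_Icc (by simp) hwa_right)
  have hleft : ∀ x ∈ Ico x₁ x₂, w_a x ∈ J ∧ w_b x ∈ J ∧ 0 ≤ (x - x₁) / (x₂ - x₁) ∧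
      deriv f (w_b x) - deriv f (w_a x) =
        (x - x₁) / (x₂ - x₁) * (deriv f u₂ - deriv f v₀) := by
    intro x hx
    refine ⟨hJ.uIcc_subset h₁ h₀ (hwa_left x hx).1, hJ.uIcc_subset h₁ h₂ (hwb_left x hx).1,
      div_nonneg (sub_nonneg.2 hx.1) (sub_pos.2 hx12).le, ?_⟩
    rw [affine_of_similarity (hne h₁ h₂ h12) hx12 (hwb_left x hx).2,
      affine_of_similarity (hne h₁ h₀ hv1.symm) hx12 (hwa_left x hx).2]
    ring
  have hright : ∀ x ∈ Icc x₂ x₄, w_a x ∈ J ∧ w_b x ∈ J ∧ 0 ≤ 1 - (x - x₂) / (x₄ - x₂) ∧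
      deriv f (w_b x) - deriv f (w_a x) =
        (1 - (x - x₂) / (x₄ - x₂)) * (deriv f u₃ - deriv f v₀) := by
    intro x hx
    refine ⟨hJ.uIcc_subset h₀ h₄ (hwa_right x hx).1, hJ.uIcc_subset h₃ h₄ (hwb_right x hx).1,
      sub_nonneg.2 ((div_le_one (sub_pos.2 hx24)).2 (sub_le_sub_right hx.2 _)), ?_⟩
    rw [affine_of_similarity (hne h₃ h₄ h34) hx24 (hwb_right x hx).2,
      affine_of_similarity (hne h₀ h₄ hv4) hx24 (hwa_right x hx).2]
    ring
  have left_le : v₀ ≤ u₂ → ∀ x ∈ Ico x₁ x₂, w_a x ≤ w_b x := by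
    intro h x hx
    obtain ⟨ma, mb, ht, e⟩ := hleft x hx
    rw [← ha.le_iff_le ma mb, ← sub_nonneg, e]
    exact mul_nonneg ht (sub_nonneg.2 (ha.monotoneOn h₀ h₂ h))
  have left_ge : u₂ ≤ v₀ → ∀ x ∈ Ico x₁ x₂, w_b x ≤ w_a x := by
    intro h x hx
    obtain ⟨ma, mb, ht, e⟩ := hleft x hx
    rw [← ha.le_iff_le mb ma, ← sub_nonpos, e]
    exact mul_nonpos_of_nonneg_of_nonpos ht (sub_nonpos.2 (ha.monotoneOn h₂ h₀ h))
  have left_ne : u₂ ≠ v₀ → ∀ x ∈ Ioo x₁ x₂, w_b x ≠ w_a x := by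
    intro h x hx hab
    obtain ⟨-, -, -, e⟩ := hleft x (Ioo_subset_Ico_self hx)
    rw [hab, sub_self] at e
    exact mul_ne_zero (div_pos (sub_pos.2 hx.1) (sub_pos.2 hx12)).ne'
      (sub_ne_zero.2 (hne h₂ h₀ h)) e.symm
  have right_ge : u₃ ≤ v₀ → ∀ x ∈ Icc x₂ x₄, w_b x ≤ w_a x := by
    intro h x hx
    obtain ⟨ma, mb, ht, e⟩ := hright x hx
    rw [← ha.le_iff_le mb ma, ← sub_nonpos, e]
    exact mul_nonpos_of_nonneg_of_nonpos ht (sub_nonpos.2 (ha.monotoneOn h₃ h₀ h))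
  have right_le : v₀ ≤ u₃ → ∀ x ∈ Icc x₂ x₄, w_a x ≤ w_b x := by
    intro h x hx
    obtain ⟨ma, mb, ht, e⟩ := hright x hx
    rw [← ha.le_iff_le ma mb, ← sub_nonneg, e]
    exact mul_nonneg ht (sub_nonneg.2 (ha.monotoneOn h₀ h₃ h))
  have hcover : ∀ x ∈ Icc x₁ x₄, x ∈ Ico x₁ x₂ ∨ x ∈ Icc x₂ x₄ := fun x hx =>
    (lt_or_ge x x₂).imp (fun h => ⟨hx.1, h⟩) (fun h => ⟨h, hx.2⟩)
  have hv2 : v₀ ≤ u₂ := by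
    by_contra! h
    refine (integral_lt_of_le_of_lt_Ioo hx12 hx24.le hIb hIa (fun x hx => ?_)
      fun x hx => ?_).ne harea.symm
    · exact (hcover x hx).elim (left_ge h.le x) (right_ge (h23.trans h).le x)
    · exact lt_of_le_of_ne (left_ge h.le x (Ioo_subset_Ico_self hx)) (left_ne h.ne x hx)
  have hv3 : u₃ ≤ v₀ := by
    by_contra! h
    refine (integral_lt_of_le_of_lt_Ioo hx12 hx24.le hIa hIb (fun x hx => ?_)
      fun x hx => ?_).ne harea
    · exact (hcover x hx).elim (left_le hv2 x) (right_le h.le x)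
    · exact lt_of_le_of_ne (left_le hv2 x (Ioo_subset_Ico_self hx))
        (left_ne (h.trans h23).ne' x hx).symm
  refine integral_abs_sub_le_of_splitting (v := v₀) hx14.le hIa hIb harea (fun x hx => ?_) k
  rcases hcover x hx with h | h
  · have hm := (hwa_left x h).1
    rw [uIcc_of_ge hfix₂] at hm
    exact Or.inl ⟨hm.1, left_le hv2 x h⟩
  · have hm := (hwa_right x h).1
    rw [uIcc_of_ge hfix₁] at hm
    exact Or.inr ⟨hm.2, right_ge hv3 x h⟩
end

section
/- Let f : ℝ → ℝ be twice continuously differentiable with f''(v) > 0 on an interval containing u₁, u₂, u₃, where u₁ > u₂ > u₃ (a resolved shock: the shock particle u₂ lies strictly between its neighbors). Let x₁ < x₂ < x₃. Extend the nonlinear average by a(w,w) = w. Then there exists a unique position x̄₂ ∈ [x₁, x₃] such that replacing the shock particle by a discontinuity at x̄₂ conserves area exactly: (x̄₂ − x₁)·u₁ + (x₃ − x̄₂)·u₃ = (x₂ − x₁)·a(u₁,u₂) + (x₃ − x₂)·a(u₂,u₃). -/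
/-- The nonlinear average of a differentiable flux with strictly increasing derivative lies strictly
between its two arguments. -/
theorem nonlinear_average_mem_Ioo_s16 {f : ℝ → ℝ} (hf : Differentiable ℝ f)
    {q p : ℝ} (hqp : q < p) (hmono : StrictMonoOn (deriv f) (Set.Icc q p)) :
    ((deriv f q * q - f q) - (deriv f p * p - f p)) / (deriv f q - deriv f p) ∈ Set.Ioo q p := by
  obtain ⟨c, ⟨hqc, hcp⟩, hc⟩ :=
    exists_deriv_eq_slope f hqp hf.continuous.continuousOn hf.differentiableOn
  have hlt₁ : deriv f q < deriv f c :=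
    hmono (Set.left_mem_Icc.2 hqp.le) ⟨hqc.le, hcp.le⟩ hqc
  have hlt₂ : deriv f c < deriv f p :=
    hmono ⟨hqc.le, hcp.le⟩ (Set.right_mem_Icc.2 hqp.le) hcp
  have hpos : 0 < p - q := sub_pos.2 hqp
  rw [eq_div_iff hpos.ne'] at hc
  have hneg : deriv f q - deriv f p < 0 := by linarith
  have hlow := mul_lt_mul_of_pos_right hlt₁ hpos
  have hupp := mul_lt_mul_of_pos_right hlt₂ hpos
  constructor
  · rw [lt_div_iff_of_neg hneg]
    linarith
  · rw [div_lt_iff_of_neg hneg]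
    linarith


/-- Shock postprocessing. For a convex C² flux and a resolved shock
`u₁ > u₂ > u₃` with particle positions `x₁ < x₂ < x₃`, there exists a unique position
`x̄₂ ∈ [x₁, x₃]` such that replacing the shock particle by a discontinuity at `x̄₂`
(taking the value `u₁` to the left and `u₃` to the right) conserves area exactly. -/
theorem shock_postprocessing_position_exists_unique
    (f : ℝ → ℝ) (hf : ContDiff ℝ 2 f)
    (J : Set ℝ) (hJ : J.OrdConnected)
    (hconv : ∀ v ∈ J, 0 < deriv (deriv f) v)
    (u₁ u₂ u₃ : ℝ) (h₁ : u₁ ∈ J) (h₂ : u₂ ∈ J) (h₃ : u₃ ∈ J)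
    (h12 : u₂ < u₁) (h23 : u₃ < u₂)
    (x₁ x₂ x₃ : ℝ) (hx₁ : x₁ < x₂) (hx₂ : x₂ < x₃)
    (a : ℝ → ℝ → ℝ)
    (ha : a = fun p q => if p = q then p else
      ((deriv f q * q - f q) - (deriv f p * p - f p)) / (deriv f q - deriv f p)) :
    ∃! xbar : ℝ, xbar ∈ Set.Icc x₁ x₃ ∧
      (xbar - x₁) * u₁ + (x₃ - xbar) * u₃
        = (x₂ - x₁) * a u₁ u₂ + (x₃ - x₂) * a u₂ u₃ := by
  have hmono : StrictMonoOn (deriv f) J := by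
    refine strictMonoOn_of_deriv_pos hJ.convex
      (hf.continuous_deriv (by norm_num)).continuousOn fun v hv => ?_
    exact hconv v (interior_subset hv)
  have hdiff : Differentiable ℝ f := hf.differentiable (by norm_num)
  have ha₁₂ : a u₁ u₂ ∈ Set.Ioo u₂ u₁ := by
    have h := nonlinear_average_mem_Ioo_s16 hdiff h12 (hmono.mono (hJ.out h₂ h₁))
    simpa only [ha, if_neg h12.ne'] using h
  have ha₂₃ : a u₂ u₃ ∈ Set.Ioo u₃ u₂ := by
    have h := nonlinear_average_mem_Ioo_s16 hdiff h23 (hmono.mono (hJ.out h₃ h₂))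
    simpa only [ha, if_neg h23.ne'] using h
  clear ha
  generalize a u₁ u₂ = b at *
  generalize a u₂ u₃ = c at *
  obtain ⟨hb₁, hb₂⟩ := ha₁₂
  obtain ⟨hc₁, hc₂⟩ := ha₂₃
  have hu : 0 < u₁ - u₃ := by linarith
  refine ⟨((x₂ - x₁) * b + (x₃ - x₂) * c + x₁ * u₁ - x₃ * u₃) / (u₁ - u₃), ⟨⟨?_, ?_⟩, ?_⟩, ?_⟩
  · rw [le_div_iff₀ hu]
    nlinarith
  · rw [div_le_iff₀ hu]
    nlinarith
  · field_simp
    ring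
  · rintro y ⟨-, hy⟩
    rw [eq_div_iff hu.ne']
    linarith
end
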